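/- For every r ∈ (0,1) there exists a unique p ∈ (0,1) such that 2·E(p)/K(p) − 1 = r. -/

import Mathlib

/-- Complete elliptic integral of the first kind. -/
noncomputable def ellipticK (p : ℝ) : ℝ :=
  ∫ z in (0:ℝ)..1, 1 / (Real.sqrt (1 - z ^ 2) * Real.sqrt (1 - p ^ 2 * z ^ 2))

/-- Complete elliptic integral of the second kind. -/
noncomputable def ellipticE (p : ℝ) : ℝ :=
  ∫ z in (0:ℝ)..1, Real.sqrt (1 - p ^ 2 * z ^ 2) / Real.sqrt (1 - z ^ 2)

open Set MeasureTheory intervalIntegral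

lemma intervalIntegrable_one_div_sqrt_one_sub_sq :
    IntervalIntegrable (fun z : ℝ => 1 / √(1 - z ^ 2)) volume 0 1 := by
  refine intervalIntegrable_deriv_of_nonneg (g := Real.arcsin)
    Real.continuous_arcsin.continuousOn (fun x hx => ?_) (fun x _ => by positivity)
  simp only [zero_le_one, inf_of_le_left, sup_of_le_right, mem_Ioo] at hx
  exact Real.hasDerivAt_arcsin (by linarith) (by linarith)

lemma one_sub_sq_le_one_sub_sq_mul_sq {p q z : ℝ} (hp : 0 ≤ p) (hpq : p ≤ q)
    (hz : z ∈ Icc (0:ℝ) 1) : 1 - q ^ 2 ≤ 1 - p ^ 2 * z ^ 2 := by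
  have hz2 : z ^ 2 ≤ 1 := pow_le_one₀ hz.1 hz.2
  have hpq2 : p ^ 2 ≤ q ^ 2 := by gcongr
  nlinarith [sq_nonneg p]

lemma one_sub_sq_mul_sq_pos {p z : ℝ} (hp : p ∈ Ico (0:ℝ) 1) (hz : z ∈ Icc (0:ℝ) 1) :
    0 < 1 - p ^ 2 * z ^ 2 := by
  have := one_sub_sq_le_one_sub_sq_mul_sq hp.1 le_rfl hz
  nlinarith [hp.1, hp.2]

lemma ellipticK_integrand_le {p q z : ℝ} (hp : 0 ≤ p) (hpq : p ≤ q) (hq : q < 1)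
    (hz : z ∈ Icc (0:ℝ) 1) :
    ‖1 / (√(1 - z ^ 2) * √(1 - p ^ 2 * z ^ 2))‖ ≤ (1 / √(1 - q ^ 2)) * (1 / √(1 - z ^ 2)) := by
  have hq2 : 0 < √(1 - q ^ 2) := Real.sqrt_pos.2 (by nlinarith)
  rw [Real.norm_of_nonneg (by positivity), mul_comm (√(1 - z ^ 2)), ← one_div_mul_one_div]
  have := one_sub_sq_le_one_sub_sq_mul_sq hp hpq hz
  gcongr ?_ * _
  exact one_div_le_one_div_of_le hq2 (Real.sqrt_le_sqrt this)

lemma ellipticE_integrand_le (p z : ℝ) :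
    ‖√(1 - p ^ 2 * z ^ 2) / √(1 - z ^ 2)‖ ≤ 1 / √(1 - z ^ 2) := by
  rw [Real.norm_of_nonneg (by positivity)]
  gcongr
  rw [Real.sqrt_le_one]
  nlinarith [sq_nonneg (p * z)]

lemma intervalIntegrable_ellipticK_integrand {p : ℝ} (hp : p ∈ Ico (0:ℝ) 1) :
    IntervalIntegrable (fun z : ℝ => 1 / (√(1 - z ^ 2) * √(1 - p ^ 2 * z ^ 2))) volume 0 1 := by
  refine (intervalIntegrable_one_div_sqrt_one_sub_sq.const_mul (1 / √(1 - p ^ 2))).mono_fun'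
    (Measurable.aestronglyMeasurable (by fun_prop)) ?_
  filter_upwards [ae_restrict_mem measurableSet_uIoc] with z hz
  rw [uIoc_of_le zero_le_one] at hz
  exact ellipticK_integrand_le hp.1 le_rfl hp.2 (Ioc_subset_Icc_self hz)

lemma intervalIntegrable_ellipticE_integrand (p : ℝ) :
    IntervalIntegrable (fun z : ℝ => √(1 - p ^ 2 * z ^ 2) / √(1 - z ^ 2)) volume 0 1 :=
  intervalIntegrable_one_div_sqrt_one_sub_sq.mono_fun'
    (Measurable.aestronglyMeasurable (by fun_prop))
    (.of_forall (ellipticE_integrand_le p))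

lemma continuous_ellipticE : Continuous ellipticE :=
  continuous_of_dominated_interval (fun p => Measurable.aestronglyMeasurable (by fun_prop))
    (fun p => .of_forall fun z _ => ellipticE_integrand_le p z)
    intervalIntegrable_one_div_sqrt_one_sub_sq
    (.of_forall fun z _ => by fun_prop)

lemma continuousOn_ellipticK {q : ℝ} (hq : q < 1) : ContinuousOn ellipticK (Icc 0 q) := by
  intro p hp
  refine continuousWithinAt_of_dominated_interval
    (.of_forall fun p => Measurable.aestronglyMeasurable (by fun_prop)) ?_
    (intervalIntegrable_one_div_sqrt_one_sub_sq.const_mul (1 / √(1 - q ^ 2)))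
    (.of_forall fun z hz => ?_)
  · filter_upwards [self_mem_nhdsWithin] with p hp
    refine .of_forall fun z hz => ?_
    rw [uIoc_of_le zero_le_one] at hz
    exact ellipticK_integrand_le hp.1 hp.2 hq (Ioc_subset_Icc_self hz)
  · rw [uIoc_of_le zero_le_one] at hz
    have hpos := Real.sqrt_pos.2
      (one_sub_sq_mul_sq_pos ⟨hp.1, hp.2.trans_lt hq⟩ (Ioc_subset_Icc_self hz))
    simp only [← one_div_mul_one_div]
    refine ContinuousWithinAt.mul continuousWithinAt_const
      (ContinuousWithinAt.div continuousWithinAt_const ?_ hpos.ne')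
    fun_prop

lemma sqrt_one_sub_sq_pos {z : ℝ} (hz : z ∈ Ioo (0:ℝ) 1) : 0 < √(1 - z ^ 2) :=
  Real.sqrt_pos.2 (by nlinarith [hz.1, hz.2])

lemma ellipticK_pos {p : ℝ} (hp : p ∈ Ico (0:ℝ) 1) : 0 < ellipticK p := by
  refine intervalIntegral_pos_of_pos_on (intervalIntegrable_ellipticK_integrand hp)
    (fun z hz => ?_) one_pos
  have h1 := Real.sqrt_pos.2 (one_sub_sq_mul_sq_pos hp (Ioo_subset_Icc_self hz))
  have h2 := sqrt_one_sub_sq_pos hz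
  positivity

lemma ellipticE_pos {p : ℝ} (hp : p ∈ Ico (0:ℝ) 1) : 0 < ellipticE p := by
  refine intervalIntegral_pos_of_pos_on (intervalIntegrable_ellipticE_integrand p)
    (fun z hz => ?_) one_pos
  have h1 := Real.sqrt_pos.2 (one_sub_sq_mul_sq_pos hp (Ioo_subset_Icc_self hz))
  have h2 := sqrt_one_sub_sq_pos hz
  positivity

lemma antitoneOn_ellipticE : AntitoneOn ellipticE (Ici 0) := by
  intro p hp q _ hpq
  refine integral_mono_on zero_le_one (intervalIntegrable_ellipticE_integrand q)
    (intervalIntegrable_ellipticE_integrand p) fun z _ => ?_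
  have : (0:ℝ) ≤ p := hp
  gcongr

lemma strictMonoOn_ellipticK : StrictMonoOn ellipticK (Ico 0 1) := by
  intro p hp q hq hpq
  have hKp := intervalIntegrable_ellipticK_integrand hp
  have hKq := intervalIntegrable_ellipticK_integrand hq
  rw [← sub_pos, ellipticK, ellipticK, ← integral_sub hKq hKp]
  refine intervalIntegral_pos_of_pos_on (hKq.sub hKp) (fun z hz => sub_pos.2 ?_) one_pos
  have h1 := one_sub_sq_mul_sq_pos hq (Ioo_subset_Icc_self hz)
  have h2 := sqrt_one_sub_sq_pos hz
  have h3 := Real.sqrt_pos.2 h1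
  have hp0 := hp.1
  have hz0 := hz.1
  gcongr

lemma strictAntiOn_ellipticE_div_ellipticK :
    StrictAntiOn (fun p => ellipticE p / ellipticK p) (Ico 0 1) := fun _ hp _ hq hpq =>
  div_lt_div₀' (antitoneOn_ellipticE hp.1 hq.1 hpq.le) (strictMonoOn_ellipticK hp hq hpq)
    (ellipticE_pos hp) (ellipticK_pos hp)

lemma ellipticE_zero_eq_ellipticK_zero : ellipticE 0 = ellipticK 0 := by
  simp [ellipticE, ellipticK]

lemma neg_log_one_sub_div_two_le_ellipticK {p : ℝ} (hp : p ∈ Ioo (0:ℝ) 1) :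
    -Real.log (1 - p) / 2 ≤ ellipticK p := by
  have hpz : ∀ z ∈ Icc (0:ℝ) 1, 0 < 1 - p * z := fun z hz => by
    nlinarith [hz.1, hz.2, hp.1, hp.2]
  have hcont : ContinuousOn (fun z : ℝ => 1 / (2 * (1 - p * z))) (uIcc 0 1) := by
    rw [uIcc_of_le zero_le_one]
    exact continuousOn_const.div (by fun_prop) fun z hz => (mul_pos two_pos (hpz z hz)).ne'
  have hint : ∫ z in (0:ℝ)..1, 1 / (2 * (1 - p * z)) = -Real.log (1 - p) / (2 * p) := by
    rw [integral_eq_sub_of_hasDerivAt (f := fun z => -Real.log (1 - p * z) / (2 * p))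
      (fun z hz => ?_) hcont.intervalIntegrable]
    · simp
    · rw [uIcc_of_le zero_le_one] at hz
      have h := hpz z hz
      have hd := (((((hasDerivAt_id' z).const_mul p).const_sub 1).log h.ne').neg).div_const (2 * p)
      refine hd.congr_deriv ?_
      have := hp.1.ne'
      field_simp
  have hlog : 0 ≤ -Real.log (1 - p) :=
    neg_nonneg.2 (Real.log_nonpos (by linarith [hp.2]) (by linarith [hp.1]))
  calc -Real.log (1 - p) / 2 ≤ -Real.log (1 - p) / (2 * p) := by
        have := hp.1
        have := hp.2
        gcongr
        linarith
    _ = ∫ z in (0:ℝ)..1, 1 / (2 * (1 - p * z)) := hint.symm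
    _ ≤ ellipticK p := by
        refine integral_mono_on_of_le_Ioo zero_le_one hcont.intervalIntegrable
          (intervalIntegrable_ellipticK_integrand ⟨hp.1.le, hp.2⟩) fun z hz => ?_
        have h1 := one_sub_sq_mul_sq_pos ⟨hp.1.le, hp.2⟩ (Ioo_subset_Icc_self hz)
        have h2 := sqrt_one_sub_sq_pos hz
        have h3 := Real.sqrt_pos.2 h1
        refine one_div_le_one_div_of_le (by positivity) ?_
        calc √(1 - z ^ 2) * √(1 - p ^ 2 * z ^ 2)
            ≤ √(1 - p ^ 2 * z ^ 2) * √(1 - p ^ 2 * z ^ 2) := by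
              gcongr
              nlinarith [pow_le_one₀ hp.1.le hp.2.le (n := 2), sq_nonneg z]
          _ = 1 - p ^ 2 * z ^ 2 := Real.mul_self_sqrt h1.le
          _ ≤ 2 * (1 - p * z) := by nlinarith [sq_nonneg (1 - p * z)]

lemma exists_le_ellipticK (M : ℝ) : ∃ p ∈ Ioo (0:ℝ) 1, M ≤ ellipticK p := by
  have hlt : Real.exp (-(2 * max M 1)) < 1 := Real.exp_lt_one_iff.2 (by
    linarith [le_max_right M 1])
  have hp : 1 - Real.exp (-(2 * max M 1)) ∈ Ioo (0:ℝ) 1 :=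
    ⟨by linarith, by linarith [Real.exp_pos (-(2 * max M 1))]⟩
  refine ⟨_, hp, le_trans ?_ (neg_log_one_sub_div_two_le_ellipticK hp)⟩
  rw [sub_sub_cancel, Real.log_exp]
  linarith [le_max_left M 1]

theorem existsUnique_p_hat {r : ℝ} (hr : r ∈ Set.Ioo (0:ℝ) 1) :
    ∃! p : ℝ, p ∈ Set.Ioo (0:ℝ) 1 ∧ 2 * ellipticE p / ellipticK p - 1 = r := by
  have h0 : (0:ℝ) ∈ Ico (0:ℝ) 1 := ⟨le_rfl, one_pos⟩
  have hzero : ellipticE 0 / ellipticK 0 = 1 := by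
    rw [ellipticE_zero_eq_ellipticK_zero, div_self (ellipticK_pos h0).ne']
  obtain ⟨q, hq, hKq⟩ := exists_le_ellipticK (2 * ellipticE 0)
  have hq' : q ∈ Ico (0:ℝ) 1 := ⟨hq.1.le, hq.2⟩
  have hEq : ellipticE q / ellipticK q ≤ 1 / 2 := by
    rw [div_le_iff₀ (ellipticK_pos hq')]
    linarith [antitoneOn_ellipticE (mem_Ici.2 le_rfl) (mem_Ici.2 hq.1.le) hq.1.le]
  have hcont : ContinuousOn (fun p => ellipticE p / ellipticK p) (Icc 0 q) :=
    continuous_ellipticE.continuousOn.div (continuousOn_ellipticK hq.2)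
      fun p hp => (ellipticK_pos ⟨hp.1, hp.2.trans_lt hq.2⟩).ne'
  obtain ⟨p, hp, hpr⟩ := intermediate_value_Icc' hq.1.le hcont
    (show (r + 1) / 2 ∈ Icc _ _ from
      ⟨by linarith [hr.1], by linarith [hr.2]⟩)
  simp only at hpr
  have hp0 : p ≠ 0 := by
    rintro rfl
    linarith [hr.2]
  refine ⟨p, ⟨⟨hp.1.lt_of_ne' hp0, hp.2.trans_lt hq.2⟩, ?_⟩, ?_⟩
  · rw [mul_div_assoc]
    linarith
  · rintro s ⟨hs, hsr⟩
    rw [mul_div_assoc] at hsr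
    refine strictAntiOn_ellipticE_div_ellipticK.injOn ⟨hs.1.le, hs.2⟩
      ⟨hp.1, hp.2.trans_lt hq.2⟩ ?_
    linarith
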